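/- arXiv:1703.07265 — 2 statements merged into one kernel-verified Lean document; each statement's English description precedes it below -/
import Mathlib

section
/- Let m ∈ ℕ and let w : ℝ → ℝ be measurable with ∫_ℝ (1 + |z|^{m+1}) |w(z)| dz < ∞ and vanishing moments ∫_ℝ z^k w(z) dz = 0 for every integer 0 ≤ k ≤ m. Let G(t,z) := (4πt)^{−1/2} exp(−z²/(4t)) for t > 0 and z ∈ ℝ. Then there exists a constant C_m > 0, depending only on m, such that for every t > 0, ‖G(t,·) * w‖_{L²(ℝ)} ≤ C_m t^{−1/4 − (m+1)/2} ∫_ℝ |z|^{m+1} |w(z)| dz. -/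
open MeasureTheory Set

/-- The one-dimensional heat kernel `G(t,z) = (4πt)^{-1/2} exp(-z²/(4t))`. -/
noncomputable def G (t z : ℝ) : ℝ :=
  (4 * Real.pi * t) ^ (-(1 : ℝ) / 2) * Real.exp (-(z ^ 2) / (4 * t))

open scoped ENNReal ContDiff

theorem iteratedDeriv_comp_add_mul {f : ℝ → ℝ} (hf : ContDiff ℝ ∞ f) (x c : ℝ) (k : ℕ) :
    iteratedDeriv k (fun s => f (x + c * s)) =
      fun s => c ^ k * iteratedDeriv k f (x + c * s) := by
  have hg : ContDiff ℝ k (fun s => f (x + s)) :=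
    (hf.comp (contDiff_const.add contDiff_id)).of_le (mod_cast le_top)
  rw [iteratedDeriv_comp_const_mul hg c, iteratedDeriv_comp_const_add]

/-- The Taylor remainder bounded by an average of the next derivative over the segment. -/
theorem enorm_taylor_remainder_le {f : ℝ → ℝ} (hf : ContDiff ℝ ∞ f) (m : ℕ) (x y : ℝ) :
    ‖f (x - y) - ∑ k ∈ Finset.range (m + 1),
        ((k.factorial : ℝ)⁻¹ * (-1) ^ k * iteratedDeriv k f x) * y ^ k‖ₑ ≤
      ∫⁻ s in Ioc (0 : ℝ) 1, ‖iteratedDeriv (m + 1) f (x - y * s)‖ₑ * ‖y‖ₑ ^ (m + 1) := by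
  have hφ : ContDiff ℝ ∞ (fun s : ℝ => f (x + -y * s)) :=
    hf.comp (contDiff_const.add (contDiff_const.mul contDiff_id))
  have hu : UniqueDiffOn ℝ (uIcc (0 : ℝ) 1) := uniqueDiffOn_uIcc zero_ne_one
  have hD : ∀ (k : ℕ), ∀ s ∈ uIcc (0 : ℝ) 1,
      iteratedDerivWithin k (fun s : ℝ => f (x + -y * s)) (uIcc 0 1) s =
        (-y) ^ k * iteratedDeriv k f (x + -y * s) := fun k s hs => by
    rw [iteratedDerivWithin_eq_iteratedDeriv hu (hφ.of_le (mod_cast le_top)).contDiffAt hs,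
      iteratedDeriv_comp_add_mul hf]
  have key := taylor_integral_remainder (n := m) (x₀ := 0) (x := 1)
    (hφ.of_le (mod_cast le_top)).contDiffOn
  have hleft : f (x - y) - ∑ k ∈ Finset.range (m + 1),
        ((k.factorial : ℝ)⁻¹ * (-1) ^ k * iteratedDeriv k f x) * y ^ k =
      ∫ s in (0 : ℝ)..1, ((1 - s) ^ m / m.factorial) •
        iteratedDerivWithin (m + 1) (fun s : ℝ => f (x + -y * s)) (uIcc 0 1) s := by
    rw [← key, taylor_within_apply]
    congr 1
    · simp [sub_eq_add_neg]
    · refine Finset.sum_congr rfl fun k _ => ?_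
      rw [hD k 0 left_mem_uIcc, neg_pow y]
      simp only [mul_zero, add_zero, sub_zero, one_pow, smul_eq_mul]
      ring
  rw [hleft, intervalIntegral.integral_of_le zero_le_one]
  refine (enorm_integral_le_lintegral_enorm _).trans
    (setLIntegral_mono' measurableSet_Ioc fun s hs => ?_)
  rw [hD (m + 1) s (by rw [uIcc_of_le zero_le_one]; exact Ioc_subset_Icc_self hs), enorm_smul,
    enorm_mul, enorm_pow, enorm_neg, mul_comm (‖y‖ₑ ^ (m + 1)), neg_mul, ← sub_eq_add_neg]
  refine mul_le_of_le_one_left' ?_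
  rw [Real.enorm_eq_ofReal_abs, ENNReal.ofReal_le_one, abs_of_nonneg (by
    have := hs.2; have : 0 ≤ 1 - s := by linarith
    positivity)]
  refine div_le_one_of_le₀ ((pow_le_one₀ (by linarith [hs.2]) (by linarith [hs.1])).trans ?_)
    (by positivity)
  exact_mod_cast m.factorial_pos

/-- The square of Minkowski's integral inequality for a family with uniformly bounded `L²` norms. -/
theorem lintegral_lintegral_sq_le {α β : Type*} [MeasurableSpace α] [MeasurableSpace β]
    {μ : Measure α} {ρ : Measure β} [SFinite μ] [SFinite ρ] {F : α → β → ℝ≥0∞}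
    (hF : Measurable (Function.uncurry F)) {D : ℝ≥0∞} (hD : ∀ p, ∫⁻ z, F z p ^ 2 ∂μ ≤ D) :
    ∫⁻ z, (∫⁻ p, F z p ∂ρ) ^ 2 ∂μ ≤ ρ univ ^ 2 * D := by
  have hcs : ∀ z, (∫⁻ p, F z p ∂ρ) ^ 2 ≤ ρ univ * ∫⁻ p, F z p ^ 2 ∂ρ := fun z => by
    have h := ENNReal.lintegral_mul_le_Lp_mul_Lq ρ Real.HolderConjugate.two_two
      (f := fun _ => 1) (g := F z) aemeasurable_const
      (hF.comp measurable_prodMk_left).aemeasurable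
    simp only [Pi.mul_apply, one_mul, ENNReal.one_rpow, lintegral_const] at h
    calc (∫⁻ p, F z p ∂ρ) ^ 2
        ≤ (ρ univ ^ (1 / 2 : ℝ) * (∫⁻ p, F z p ^ (2 : ℝ) ∂ρ) ^ (1 / 2 : ℝ)) ^ 2 := by gcongr
      _ = _ := by
        rw [mul_pow, ← ENNReal.rpow_mul_natCast, ← ENNReal.rpow_mul_natCast]
        norm_num
  calc ∫⁻ z, (∫⁻ p, F z p ∂ρ) ^ 2 ∂μ ≤ ∫⁻ z, ρ univ * ∫⁻ p, F z p ^ 2 ∂ρ ∂μ :=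
        lintegral_mono hcs
    _ = ρ univ * ∫⁻ p, ∫⁻ z, F z p ^ 2 ∂μ ∂ρ := by
        rw [lintegral_const_mul _ (Measurable.lintegral_prod_right'
          (f := fun q : α × β => F q.1 q.2 ^ 2) (hF.pow_const 2)),
          lintegral_lintegral_swap (hF.pow_const 2).aemeasurable]
    _ ≤ ρ univ * (D * ρ univ) := by
        gcongr
        exact (lintegral_mono hD).trans_eq (lintegral_const D)
    _ = _ := by ring

theorem abs_pow_le_one_add_pow {k n : ℕ} (h : k ≤ n) (z : ℝ) : |z| ^ k ≤ 1 + |z| ^ n := by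
  rcases le_total |z| 1 with hz | hz
  · exact (pow_le_one₀ (abs_nonneg z) hz).trans (by simp)
  · exact (pow_le_pow_right₀ hz h).trans (by simp)

theorem integrable_pow_mul_of_le {n k : ℕ} {w : ℝ → ℝ} (hw : Measurable w)
    (hi : Integrable (fun z => (1 + |z| ^ n) * |w z|)) (hk : k ≤ n) :
    Integrable (fun z => z ^ k * w z) := by
  refine hi.mono' (by fun_prop) (.of_forall fun z => ?_)
  rw [norm_mul, norm_pow, Real.norm_eq_abs, Real.norm_eq_abs]
  gcongr
  exact abs_pow_le_one_add_pow hk z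

/-- Young's inequality with vanishing moments: convolution of a bounded smooth `f` against `w` is
controlled in `L²` by the next derivative of `f`. -/
theorem eLpNorm_convolution_le_of_moments {f : ℝ → ℝ} (hf : ContDiff ℝ ∞ f) {B : ℝ}
    (hB : ∀ x, |f x| ≤ B) {m : ℕ} {w : ℝ → ℝ} (hw : Measurable w)
    (hi : Integrable (fun z => (1 + |z| ^ (m + 1)) * |w z|))
    (hmom : ∀ k : ℕ, k ≤ m → ∫ z : ℝ, z ^ k * w z = 0) :
    eLpNorm (fun z => ∫ z', f (z - z') * w z') 2 volume ≤
      ENNReal.ofReal (∫ z : ℝ, |z| ^ (m + 1) * |w z|) *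
        eLpNorm (iteratedDeriv (m + 1) f) 2 volume := by
  set κ : ℝ → ℝ≥0∞ := fun z => ‖z‖ₑ ^ (m + 1) * ‖w z‖ₑ with hκ
  have hκm : Measurable κ := by fun_prop
  have hdc : Continuous (iteratedDeriv (m + 1) f) := hf.continuous_iteratedDeriv _ (mod_cast le_top)
  have hdm : Measurable (fun x => ‖iteratedDeriv (m + 1) f x‖ₑ) := hdc.measurable.enorm
  have hκi : ∫⁻ z, κ z = ENNReal.ofReal (∫ z : ℝ, |z| ^ (m + 1) * |w z|) := by
    have h := (integrable_pow_mul_of_le hw hi le_rfl).norm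
    simp only [norm_mul, norm_pow, Real.norm_eq_abs] at h
    rw [ofReal_integral_eq_lintegral_ofReal h (.of_forall fun z => by positivity)]
    refine lintegral_congr fun z => ?_
    rw [hκ, ENNReal.ofReal_mul (by positivity), ENNReal.ofReal_pow (abs_nonneg z)]
    simp only [Real.enorm_eq_ofReal_abs]
  set ν : Measure ℝ := volume.withDensity κ
  set ρ : Measure (ℝ × ℝ) := ν.prod (volume.restrict (Ioc 0 1))
  have hρ : ρ univ = ENNReal.ofReal (∫ z : ℝ, |z| ^ (m + 1) * |w z|) := by
    rw [← univ_prod_univ, Measure.prod_prod, withDensity_apply _ .univ]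
    simp [hκi]
  have hcancel : ∀ z, ∫ z', f (z - z') * w z' =
      ∫ z', (f (z - z') - ∑ k ∈ Finset.range (m + 1),
        ((k.factorial : ℝ)⁻¹ * (-1) ^ k * iteratedDeriv k f z) * z' ^ k) * w z' := fun z => by
    have hfi : Integrable (fun z' => f (z - z') * w z') := by
      have hw' : Integrable w := by
        simpa using integrable_pow_mul_of_le hw hi (Nat.zero_le (m + 1))
      exact hw'.bdd_mul (c := B)
        (hf.continuous.comp (continuous_const.sub continuous_id)).aestronglyMeasurable
        (.of_forall fun z' => hB _)
    have hti : ∀ k ∈ Finset.range (m + 1), Integrable (fun z' =>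
        ((k.factorial : ℝ)⁻¹ * (-1) ^ k * iteratedDeriv k f z) * (z' ^ k * w z')) :=
      fun k hk => (integrable_pow_mul_of_le hw hi (Finset.mem_range.mp hk).le).const_mul _
    simp_rw [sub_mul, Finset.sum_mul, mul_assoc _ (_ ^ _) (w _)]
    rw [integral_sub hfi (integrable_finsetSum _ hti), integral_finsetSum _ hti,
      Finset.sum_eq_zero fun k hk => ?_, sub_zero]
    rw [integral_const_mul, hmom k (Nat.lt_succ_iff.mp (Finset.mem_range.mp hk)), mul_zero]
  have hpoint : ∀ z, ‖∫ z', f (z - z') * w z'‖ₑ ≤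
      ∫⁻ p, ‖iteratedDeriv (m + 1) f (z - p.1 * p.2)‖ₑ ∂ρ := fun z => by
    have hm : Measurable (fun p : ℝ × ℝ => ‖iteratedDeriv (m + 1) f (z - p.1 * p.2)‖ₑ) :=
      hdm.comp (by fun_prop)
    rw [hcancel, lintegral_prod _ hm.aemeasurable,
      lintegral_withDensity_eq_lintegral_mul _ hκm
        hm.lintegral_prod_right']
    refine (enorm_integral_le_lintegral_enorm _).trans (lintegral_mono fun z' => ?_)
    rw [enorm_mul]
    refine (mul_le_mul_left (enorm_taylor_remainder_le hf m z z') _).trans_eq ?_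
    rw [lintegral_mul_const' _ _ (ENNReal.pow_ne_top enorm_ne_top), Pi.mul_apply, hκ]
    ring
  have hsq : ∀ g : ℝ → ℝ, eLpNorm g 2 volume = (∫⁻ z, ‖g z‖ₑ ^ 2) ^ (1 / 2 : ℝ) := fun g => by
    simp [eLpNorm_eq_lintegral_rpow_enorm_toReal two_ne_zero ENNReal.ofNat_ne_top]
  rw [hsq, hsq, ← hρ]
  calc (∫⁻ z, ‖∫ z', f (z - z') * w z'‖ₑ ^ 2) ^ (1 / 2 : ℝ)
      ≤ (ρ univ ^ 2 * ∫⁻ z, ‖iteratedDeriv (m + 1) f z‖ₑ ^ 2) ^ (1 / 2 : ℝ) := by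
        refine ENNReal.rpow_le_rpow ((lintegral_mono fun z => ?_).trans
          (lintegral_lintegral_sq_le (μ := volume) (ρ := ρ)
            (F := fun z p => ‖iteratedDeriv (m + 1) f (z - p.1 * p.2)‖ₑ)
            (hdm.comp (by fun_prop)) fun p => ?_)) (by norm_num)
        · exact pow_le_pow_left' (hpoint z) 2
        · exact (lintegral_sub_right_eq_self
            (fun z => ‖iteratedDeriv (m + 1) f z‖ₑ ^ 2) (p.1 * p.2)).le
    _ = _ := by
        rw [ENNReal.mul_rpow_of_nonneg _ _ (by norm_num), ← ENNReal.rpow_natCast_mul]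
        norm_num

/-- Scaling of the `L²` norm. -/
theorem eLpNorm_two_comp_mul_left {g : ℝ → ℝ} (hg : Measurable g) {a : ℝ} (ha : 0 < a) :
    eLpNorm (fun z => g (a * z)) 2 volume =
      ENNReal.ofReal (a ^ (-(1 : ℝ) / 2)) * eLpNorm g 2 volume := by
  have hmap : Measure.map (a * ·) volume = ENNReal.ofReal a⁻¹ • (volume : Measure ℝ) := by
    rw [Real.map_volume_mul_left ha.ne', abs_of_pos (inv_pos.mpr ha)]
  have h := eLpNorm_map_measure (p := 2) (μ := volume) (f := (a * · : ℝ → ℝ)) (g := g)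
    hg.aestronglyMeasurable (by fun_prop)
  rw [hmap, eLpNorm_smul_measure_of_ne_top (by norm_num)] at h
  rw [show (fun z => g (a * z)) = g ∘ (a * ·) from rfl, ← h, smul_eq_mul,
    ENNReal.ofReal_rpow_of_pos (inv_pos.mpr ha), Real.inv_rpow ha.le, ← Real.rpow_neg ha.le]
  norm_num [neg_div]

theorem integrable_eval_mul_exp_neg_mul_sq (p : Polynomial ℝ) {b : ℝ} (hb : 0 < b) :
    Integrable (fun x : ℝ => p.eval x * Real.exp (-b * x ^ 2)) := by
  induction p using Polynomial.induction_on' with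
  | add p q hp hq =>
    simp only [Polynomial.eval_add, add_mul]
    exact hp.add hq
  | monomial n c =>
    have h := (integrable_rpow_mul_exp_neg_mul_sq hb
      (s := n) (by linarith [n.cast_nonneg (α := ℝ)])).const_mul c
    simpa [mul_assoc] using h

theorem contDiff_gaussian : ContDiff ℝ ∞ (fun y : ℝ => Real.exp (-(y ^ 2 / 2))) := by
  fun_prop

theorem memLp_two_iteratedDeriv_gaussian (n : ℕ) :
    MemLp (iteratedDeriv n (fun y : ℝ => Real.exp (-(y ^ 2 / 2)))) 2 volume := by
  refine (memLp_two_iff_integrable_sq (contDiff_gaussian.continuous_iteratedDeriv _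
    (mod_cast le_top)).aestronglyMeasurable).mpr ?_
  have h := integrable_eval_mul_exp_neg_mul_sq
    (((Polynomial.hermite n).map (Int.castRingHom ℝ)) ^ 2) one_pos
  refine h.congr (.of_forall fun x => ?_)
  simp only [iteratedDeriv_eq_iterate, Polynomial.deriv_gaussian_eq_hermite_mul_gaussian, mul_pow,
    ← Real.exp_nat_mul, Polynomial.eval_pow, Polynomial.eval_map, Polynomial.aeval_def]
  rw [← pow_mul, mul_comm n 2, pow_mul, neg_one_sq, one_pow, one_mul]
  congr 2
  push_cast; ring

theorem statement7 (m : ℕ) :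
    ∃ C > (0 : ℝ), ∀ w : ℝ → ℝ, Measurable w →
      Integrable (fun z => (1 + |z| ^ (m + 1)) * |w z|) →
      (∀ k : ℕ, k ≤ m → ∫ z : ℝ, z ^ k * w z = 0) →
      ∀ t > (0 : ℝ),
        eLpNorm (fun z => ∫ z', G t (z - z') * w z') 2 volume
          ≤ ENNReal.ofReal
              (C * t ^ (-(1 : ℝ) / 4 - ((m : ℝ) + 1) / 2) * ∫ z : ℝ, |z| ^ (m + 1) * |w z|) := by
  set g : ℝ → ℝ := fun y => Real.exp (-(y ^ 2 / 2))
  set D : ℝ := (eLpNorm (iteratedDeriv (m + 1) g) 2 volume).toReal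
  have hD : eLpNorm (iteratedDeriv (m + 1) g) 2 volume ≤ ENNReal.ofReal (D + 1) := by
    rw [← ENNReal.ofReal_toReal (memLp_two_iteratedDeriv_gaussian (m + 1)).eLpNorm_ne_top]
    exact ENNReal.ofReal_le_ofReal (le_add_of_nonneg_right zero_le_one)
  have hD0 : 0 ≤ D := ENNReal.toReal_nonneg
  refine ⟨(4 * Real.pi) ^ (-(1 : ℝ) / 2) * (2 : ℝ) ^ ((1 : ℝ) / 4 - ((m : ℝ) + 1) / 2) * (D + 1),
    by positivity, fun w hw hi hmom t ht => ?_⟩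
  set c : ℝ := (4 * Real.pi * t) ^ (-(1 : ℝ) / 2) with hc
  set a : ℝ := (2 * t) ^ (-(1 : ℝ) / 2) with ha
  have hc0 : 0 < c := by positivity
  have ha0 : 0 < a := by positivity
  have ha2 : a ^ 2 = (2 * t)⁻¹ := by
    rw [ha, ← Real.rpow_mul_natCast (by positivity), ← Real.rpow_neg_one]
    norm_num
  have hG : G t = fun z => c * g (0 + a * z) := by
    funext z
    simp only [G, g, zero_add, mul_pow, ha2, hc]
    congr 2
    field_simp
    ring
  have hGs : ContDiff ℝ ∞ (G t) := by
    rw [hG]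
    exact contDiff_const.mul (contDiff_gaussian.comp
      (contDiff_const.add (contDiff_const.mul contDiff_id)))
  have hGB : ∀ x, |G t x| ≤ c := fun x => by
    rw [hG, abs_of_nonneg (by positivity)]
    exact mul_le_of_le_one_right hc0.le (Real.exp_le_one_iff.mpr (by simp; positivity))
  have hGd : iteratedDeriv (m + 1) (G t) =
      (c * a ^ (m + 1)) • fun z => iteratedDeriv (m + 1) g (a * z) := by
    funext z
    rw [hG, iteratedDeriv_const_mul_field, iteratedDeriv_comp_add_mul contDiff_gaussian]
    simp [mul_assoc, g]
  have hpow : c * a ^ (m + 1) * a ^ (-(1 : ℝ) / 2) = (4 * Real.pi) ^ (-(1 : ℝ) / 2) *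
      (2 : ℝ) ^ ((1 : ℝ) / 4 - ((m : ℝ) + 1) / 2) * t ^ (-(1 : ℝ) / 4 - ((m : ℝ) + 1) / 2) := by
    rw [mul_assoc c, ← Real.rpow_natCast a, ← Real.rpow_add ha0, ha,
      ← Real.rpow_mul (by positivity), hc, Real.mul_rpow (by positivity) ht.le,
      Real.mul_rpow zero_le_two ht.le,
      show -(1 : ℝ) / 4 - ((m : ℝ) + 1) / 2 = -(1 : ℝ) / 2 + (1 / 4 - ((m : ℝ) + 1) / 2) by ring,
      Real.rpow_add ht,
      show -(1 : ℝ) / 2 * (((m + 1 : ℕ) : ℝ) + -1 / 2) = 1 / 4 - ((m : ℝ) + 1) / 2 by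
        push_cast; ring]
    ring
  refine (eLpNorm_convolution_le_of_moments hGs hGB hw hi hmom).trans ?_
  have hI : 0 ≤ ∫ z : ℝ, |z| ^ (m + 1) * |w z| := integral_nonneg fun z => by positivity
  rw [hGd, eLpNorm_const_smul, eLpNorm_two_comp_mul_left
    (contDiff_gaussian.continuous_iteratedDeriv _ (mod_cast le_top)).measurable ha0,
    Real.enorm_eq_ofReal (by positivity), ← mul_assoc (ENNReal.ofReal (c * _)),
    ← ENNReal.ofReal_mul (by positivity), hpow]
  refine (mul_le_mul_right (mul_le_mul_right hD _) _).trans_eq ?_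
  rw [← ENNReal.ofReal_mul (by positivity), ← ENNReal.ofReal_mul hI]
  congr 1
  ring
end

section
/- Let m ∈ ℕ and let v̄ : ℝ → ℝ be a bounded continuous function, supported in [0,∞), with ∫₀^∞ (1 + z^{m+1}) |v̄(z)| dz < ∞ and vanishing half-line moments ∫₀^∞ z^k v̄(z) dz = 0 for every integer 0 ≤ k ≤ m. Define, for t > 0 and z ∈ ℝ, v(t,z) := ∫₀^∞ (G(t, z − z′) + G(t, z + z′)) v̄(z′) dz′, where G(t,z) := (4πt)^{−1/2} exp(−z²/(4t)). Then there exists a constant C_m > 0, depending only on m, such that for every t > 0, (∫₀^∞ |v(t,z)|² dz)^{1/2} ≤ C_m t^{−1/4 − (m+1)/2} ∫₀^∞ z^{m+1} |v̄(z)| dz. -/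
open MeasureTheory Set

/-- The solution of the Neumann problem on the half-line by even reflection. -/
noncomputable def v (vb : ℝ → ℝ) (t z : ℝ) : ℝ :=
  ∫ z' in Ioi (0 : ℝ), (G t (z - z') + G t (z + z')) * vb z'

theorem exists_enorm_sub_sum_le {m : ℕ} {f : ℝ → ℝ} (hf : ContDiff ℝ (m + 1 : ℕ) f) :
    ∃ c : ℕ → ℝ, ∀ y > 0, ‖f y - ∑ k ∈ Finset.range (m + 1), c k * y ^ k‖ₑ ≤
      ∫⁻ s in Ioc (0 : ℝ) 1, ENNReal.ofReal (y ^ (m + 1)) * ‖iteratedDeriv (m + 1) f (s * y)‖ₑ := by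
  refine ⟨fun k => (k.factorial : ℝ)⁻¹ * iteratedDeriv k f 0, fun y hy => ?_⟩
  have hu : UniqueDiffOn ℝ (uIcc 0 y) := uniqueDiffOn_uIcc hy.ne
  have hw : ∀ k ≤ m + 1, ∀ x ∈ uIcc 0 y, iteratedDerivWithin k f (uIcc 0 y) x
      = iteratedDeriv k f x := fun k hk x hx =>
    iteratedDerivWithin_eq_iteratedDeriv hu
      (hf.contDiffAt.of_le (by exact_mod_cast hk)) hx
  have hc : Continuous (iteratedDeriv (m + 1) f) := hf.continuous_iteratedDeriv _ le_rfl
  have key := taylor_integral_remainder (n := m) (x₀ := 0) (x := y) hf.contDiffOn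
  have hT : taylorWithinEval f m (uIcc 0 y) 0 y
      = ∑ k ∈ Finset.range (m + 1), (k.factorial : ℝ)⁻¹ * iteratedDeriv k f 0 * y ^ k := by
    rw [taylor_within_apply]
    refine Finset.sum_congr rfl fun k hk => ?_
    rw [hw k (by have := Finset.mem_range.1 hk; omega) 0 left_mem_uIcc]
    simp only [sub_zero, smul_eq_mul]; ring
  rw [← hT, key]
  calc
    _ = ENNReal.ofReal ‖∫ t in (0 : ℝ)..y, ((y - t) ^ m / m.factorial) •
          iteratedDerivWithin (m + 1) f (uIcc 0 y) t‖ := (ofReal_norm _).symm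
    _ ≤ ENNReal.ofReal (∫ t in (0 : ℝ)..y, y ^ m * ‖iteratedDeriv (m + 1) f t‖) := by
      refine ENNReal.ofReal_le_ofReal ?_
      refine intervalIntegral.norm_integral_le_of_norm_le hy.le ?_
        (Continuous.intervalIntegrable (by fun_prop) _ _)
      refine Filter.Eventually.of_forall fun t ht => ?_
      rw [hw _ le_rfl t (by rw [uIcc_of_le hy.le]; exact ⟨ht.1.le, ht.2⟩), norm_smul]
      refine mul_le_mul_of_nonneg_right ?_ (norm_nonneg _)
      have h0 : 0 ≤ y - t := by linarith [ht.2]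
      rw [Real.norm_of_nonneg (by positivity)]
      refine (div_le_self (by positivity) (by exact_mod_cast Nat.factorial_pos m)).trans ?_
      exact pow_le_pow_left₀ h0 (by linarith [ht.1]) m
    _ = ENNReal.ofReal (∫ s in (0 : ℝ)..1, y ^ (m + 1) * ‖iteratedDeriv (m + 1) f (s * y)‖) := by
      congr 1
      have := intervalIntegral.integral_comp_mul_right (a := 0) (b := 1)
        (fun t => ‖iteratedDeriv (m + 1) f t‖) hy.ne'
      rw [intervalIntegral.integral_const_mul, intervalIntegral.integral_const_mul, this]
      simp only [zero_mul, one_mul, smul_eq_mul]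
      field_simp
      ring
    _ = ∫⁻ s in Ioc (0 : ℝ) 1,
          ENNReal.ofReal (y ^ (m + 1) * ‖iteratedDeriv (m + 1) f (s * y)‖) := by
      rw [intervalIntegral.integral_of_le zero_le_one, ofReal_integral_eq_lintegral_ofReal]
      · exact ((Continuous.intervalIntegrable (by fun_prop) 0 1).1)
      · exact Filter.Eventually.of_forall fun s => by positivity
    _ = _ := by
      refine lintegral_congr fun s => ?_
      rw [ENNReal.ofReal_mul (by positivity), ofReal_norm]

theorem sq_lintegral_le {α : Type*} [MeasurableSpace α] (μ : Measure α) {h : α → ENNReal}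
    (hh : AEMeasurable h μ) : (∫⁻ a, h a ∂μ) ^ 2 ≤ μ univ * ∫⁻ a, h a ^ 2 ∂μ := by
  have := ENNReal.lintegral_mul_le_Lp_mul_Lq μ Real.HolderConjugate.two_two
    (f := fun _ => 1) aemeasurable_const hh
  simp only [Pi.mul_apply, one_mul, ENNReal.one_rpow, lintegral_one] at this
  refine (pow_le_pow_left' this 2).trans_eq ?_
  rw [mul_pow, ← ENNReal.rpow_natCast, ← ENNReal.rpow_natCast, ← ENNReal.rpow_mul,
    ← ENNReal.rpow_mul]
  norm_num

theorem lintegral_sq_lintegral_comp_add_le {α : Type*} [MeasurableSpace α] (μ : Measure α)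
    [SFinite μ] {h : ℝ → ENNReal} (hh : Measurable h) {φ : α → ℝ} (hφ : Measurable φ) :
    ∫⁻ z, (∫⁻ a, h (z + φ a) ∂μ) ^ 2 ≤ μ univ ^ 2 * ∫⁻ z, h z ^ 2 := by
  calc
    _ ≤ ∫⁻ z, μ univ * ∫⁻ a, h (z + φ a) ^ 2 ∂μ :=
      lintegral_mono fun z => sq_lintegral_le μ (by fun_prop)
    _ = μ univ * ∫⁻ z, ∫⁻ a, h (z + φ a) ^ 2 ∂μ :=
      lintegral_const_mul _ (Measurable.lintegral_prod_right (by fun_prop))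
    _ = μ univ * ∫⁻ a, (∫⁻ z, h (z + φ a) ^ 2) ∂μ := by
      rw [lintegral_lintegral_swap (by fun_prop)]
    _ = _ := by
      simp_rw [lintegral_add_right_eq_self (fun z => h z ^ 2)]
      rw [lintegral_const]; ring

/-- Integrating a smooth kernel against a function with `m + 1` vanishing moments. -/
theorem lintegral_sq_enorm_integral_le {m : ℕ} {g w : ℝ → ℝ} (hg : ContDiff ℝ (m + 1 : ℕ) g)
    {B : ℝ} (hB : ∀ x, ‖g x‖ ≤ B) (hw : Measurable w)
    (hi : ∀ k ≤ m, IntegrableOn (fun y => y ^ k * w y) (Ioi 0))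
    (hmom : ∀ k ≤ m, ∫ y in Ioi (0 : ℝ), y ^ k * w y = 0) {σ : ℝ} (hσ : |σ| = 1) :
    ∫⁻ z, ‖∫ y in Ioi (0 : ℝ), g (z + σ * y) * w y‖ₑ ^ 2 ≤
      (∫⁻ y in Ioi (0 : ℝ), ENNReal.ofReal (y ^ (m + 1)) * ‖w y‖ₑ) ^ 2 *
        ∫⁻ x, ‖iteratedDeriv (m + 1) g x‖ₑ ^ 2 := by
  have hc : Continuous (iteratedDeriv (m + 1) g) := hg.continuous_iteratedDeriv _ le_rfl
  have hcm := hc.measurable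
  have hgc : Continuous g := hg.continuous
  set ρ : ℝ → ENNReal := fun y => ENNReal.ofReal (y ^ (m + 1)) * ‖w y‖ₑ with hρ
  have hρm : Measurable ρ := by fun_prop
  set μ := ((volume.restrict (Ioi (0 : ℝ))).withDensity ρ).prod (volume.restrict (Ioc (0 : ℝ) 1))
    with hμ
  have huniv : μ univ = ∫⁻ y in Ioi (0 : ℝ), ρ y := by
    rw [hμ, ← univ_prod_univ, Measure.prod_prod]
    simp
  rw [← huniv]
  refine le_trans (lintegral_mono fun z => ?_) (lintegral_sq_lintegral_comp_add_le μ
    (h := fun x => ‖iteratedDeriv (m + 1) g x‖ₑ) (by fun_prop)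
    (φ := fun p => p.2 * σ * p.1) (by fun_prop))
  refine pow_le_pow_left' ?_ 2
  obtain ⟨c, hcT⟩ := exists_enorm_sub_sum_le (m := m) (f := fun y => g (z + σ * y))
    (hg.comp (by fun_prop))
  have hder : iteratedDeriv (m + 1) (fun y => g (z + σ * y))
      = fun y => σ ^ (m + 1) * iteratedDeriv (m + 1) g (z + σ * y) := by
    have h1 : ContDiff ℝ (m + 1 : ℕ) (fun y => g (z + y)) := hg.comp (by fun_prop)
    rw [iteratedDeriv_comp_const_mul h1 σ, iteratedDeriv_comp_const_add]
  have hnorm : ∀ y, ‖iteratedDeriv (m + 1) (fun y => g (z + σ * y)) y‖ₑ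
      = ‖iteratedDeriv (m + 1) g (z + σ * y)‖ₑ := fun y => by
    rw [hder, ← ofReal_norm, ← ofReal_norm, norm_mul, norm_pow, Real.norm_eq_abs σ, hσ]; simp
  have hw0 : IntegrableOn w (Ioi 0) := by simpa using hi 0 (Nat.zero_le _)
  have hsub : ∫ y in Ioi (0 : ℝ), g (z + σ * y) * w y = ∫ y in Ioi (0 : ℝ),
      (g (z + σ * y) - ∑ k ∈ Finset.range (m + 1), c k * y ^ k) * w y := by
    have hs : ∀ k ∈ Finset.range (m + 1), IntegrableOn (fun y => c k * (y ^ k * w y)) (Ioi 0) :=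
      fun k hk => (hi k (by have := Finset.mem_range.1 hk; omega)).const_mul _
    simp_rw [sub_mul, Finset.sum_mul, mul_assoc (c _)]
    rw [integral_sub _ (integrable_finsetSum _ hs), integral_finsetSum _ hs,
      Finset.sum_eq_zero, sub_zero]
    · intro k hk
      rw [integral_const_mul, hmom k (by have := Finset.mem_range.1 hk; omega), mul_zero]
    · exact hw0.bdd_mul (c := B) (by fun_prop) (Filter.Eventually.of_forall fun y => hB _)
  calc
    _ ≤ ∫⁻ y in Ioi (0 : ℝ), ‖(g (z + σ * y) - ∑ k ∈ Finset.range (m + 1), c k * y ^ k) * w y‖ₑ := by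
      rw [hsub]; exact enorm_integral_le_lintegral_enorm _
    _ ≤ ∫⁻ y in Ioi (0 : ℝ), ρ y * ∫⁻ s in Ioc (0 : ℝ) 1,
          ‖iteratedDeriv (m + 1) g (z + s * σ * y)‖ₑ := by
      refine setLIntegral_mono' measurableSet_Ioi fun y hy => ?_
      rw [enorm_mul, mul_comm]
      refine (mul_le_mul_right (hcT y hy) _).trans_eq ?_
      simp_rw [hnorm]
      rw [lintegral_const_mul _ (by fun_prop), hρ]
      simp only [mul_assoc, mul_left_comm σ]
      ring
    _ = _ := by
      rw [hμ, lintegral_prod _ (by fun_prop), lintegral_withDensity_eq_lintegral_mul _ hρm]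
      · rfl
      · exact Measurable.lintegral_prod_right (by fun_prop)

theorem integrable_polynomial_mul_exp_neg_sq (p : Polynomial ℝ) :
    Integrable fun x : ℝ => p.eval x * Real.exp (-x ^ 2) := by
  induction p using Polynomial.induction_on' with
  | add p q hp hq =>
    refine (hp.add hq).congr (Filter.Eventually.of_forall fun x => ?_)
    simp [add_mul]
  | monomial n a =>
    have := (integrable_rpow_mul_exp_neg_mul_sq one_pos
      (s := n) (by linarith [n.cast_nonneg (α := ℝ)])).const_mul a
    refine this.congr (Filter.Eventually.of_forall fun x => ?_)
    simp [mul_assoc]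

/-- The derivatives of the standard Gaussian are square integrable. -/
theorem lintegral_sq_iteratedDeriv_gaussian_lt_top (n : ℕ) :
    ∫⁻ x, ‖iteratedDeriv n (fun y : ℝ => Real.exp (-(y ^ 2 / 2))) x‖ₑ ^ 2 < ⊤ := by
  have h := integrable_polynomial_mul_exp_neg_sq
    ((Polynomial.hermite n).map (Int.castRingHom ℝ) ^ 2)
  refine lt_of_eq_of_lt (lintegral_congr fun x => ?_) h.hasFiniteIntegral
  rw [iteratedDeriv_eq_iterate, Polynomial.deriv_gaussian_eq_hermite_mul_gaussian, ← enorm_pow]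
  congr 1
  rw [mul_pow, mul_pow, ← pow_mul, mul_comm n 2, pow_mul, ← Real.exp_nat_mul, Polynomial.aeval_def]
  simp only [Polynomial.eval_pow, Polynomial.eval_map, even_two, Even.neg_pow, one_pow, one_mul, algebraMap_int_eq]
  congr 2
  push_cast; ring

theorem G_eq_mul_gaussian {t : ℝ} (ht : 0 < t) :
    G t = fun z => (4 * Real.pi * t) ^ (-(1 : ℝ) / 2) *
      (fun y : ℝ => Real.exp (-(y ^ 2 / 2))) ((2 * t) ^ (-(1 : ℝ) / 2) * z) := by
  ext z
  simp only [G]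
  congr 2
  rw [mul_pow, ← Real.rpow_natCast ((2 * t) ^ (-(1 : ℝ) / 2)), ← Real.rpow_mul (by positivity)]
  norm_num [Real.rpow_neg_one]
  field_simp
  norm_num

theorem contDiff_G {t : ℝ} (ht : 0 < t) {n : WithTop ℕ∞} : ContDiff ℝ n (G t) := by
  rw [G_eq_mul_gaussian ht]; fun_prop

theorem norm_G_le {t : ℝ} (ht : 0 < t) (z : ℝ) : ‖G t z‖ ≤ (4 * Real.pi * t) ^ (-(1 : ℝ) / 2) := by
  have hp : 0 ≤ (4 * Real.pi * t) ^ (-(1 : ℝ) / 2) := by positivity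
  rw [G, norm_mul, Real.norm_of_nonneg hp, Real.norm_of_nonneg (Real.exp_nonneg _)]
  refine mul_le_of_le_one_right hp (Real.exp_le_one_iff.2 ?_)
  exact div_nonpos_of_nonpos_of_nonneg (by nlinarith) (by positivity)

theorem lintegral_comp_const_mul {c : ℝ} (hc : 0 < c) {h : ℝ → ENNReal} (hh : Measurable h) :
    ∫⁻ x, h (c * x) = ENNReal.ofReal c⁻¹ * ∫⁻ x, h x := by
  have := lintegral_map (μ := volume) hh (measurable_const_mul c)
  rw [← this, Real.map_volume_mul_left hc.ne', lintegral_smul_measure, abs_of_pos (by positivity)]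
  rfl

/-- Scaling of the `L²` norm of the derivatives of the heat kernel. -/
theorem lintegral_sq_iteratedDeriv_G_le (m : ℕ) {t : ℝ} (ht : 0 < t) :
    ∫⁻ x, ‖iteratedDeriv (m + 1) (G t) x‖ₑ ^ 2 ≤
      ENNReal.ofReal ((t ^ (-(1 : ℝ) / 4 - ((m : ℝ) + 1) / 2)) ^ 2) *
        ∫⁻ x, ‖iteratedDeriv (m + 1) (fun y : ℝ => Real.exp (-(y ^ 2 / 2))) x‖ₑ ^ 2 := by
  have hφ : ContDiff ℝ (m + 1 : ℕ) (fun y : ℝ => Real.exp (-(y ^ 2 / 2))) := by fun_prop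
  have hm : Measurable (iteratedDeriv (m + 1) (fun y : ℝ => Real.exp (-(y ^ 2 / 2)))) :=
    (hφ.continuous_iteratedDeriv _ le_rfl).measurable
  rw [G_eq_mul_gaussian ht]
  set φ : ℝ → ℝ := fun y : ℝ => Real.exp (-(y ^ 2 / 2)) with hφ_def
  set a := (4 * Real.pi * t) ^ (-(1 : ℝ) / 2) with ha
  set b := (2 * t) ^ (-(1 : ℝ) / 2) with hb
  have hb0 : 0 < b := by positivity
  have ha0 : 0 < a := by positivity
  have hder : ∀ x, ‖iteratedDeriv (m + 1) (fun z => a * φ (b * z)) x‖ₑ ^ 2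
      = ENNReal.ofReal ((a * b ^ (m + 1)) ^ 2) * ‖iteratedDeriv (m + 1) φ (b * x)‖ₑ ^ 2 := by
    intro x
    rw [iteratedDeriv_const_mul_field, iteratedDeriv_comp_const_mul hφ, ← mul_assoc, enorm_mul,
      mul_pow, Real.enorm_of_nonneg (by positivity), ENNReal.ofReal_pow (by positivity)]
  simp_rw [hder]
  rw [lintegral_const_mul _ (by fun_prop),
    lintegral_comp_const_mul hb0 (h := fun x => ‖iteratedDeriv (m + 1) φ x‖ₑ ^ 2) (by fun_prop),
    ← mul_assoc, ← ENNReal.ofReal_mul (by positivity)]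
  gcongr
  have ha2 : a ^ 2 ≤ t ^ (-1 : ℝ) := by
    rw [ha, ← Real.rpow_natCast, ← Real.rpow_mul (by positivity)]
    norm_num only
    refine Real.rpow_le_rpow_of_nonpos ht ?_ (by norm_num)
    nlinarith [Real.pi_gt_three]
  have hb2 : b ^ (2 * m + 1) ≤ t ^ (-(1 : ℝ) / 2 * (2 * m + 1 : ℕ)) := by
    rw [hb, ← Real.rpow_natCast, ← Real.rpow_mul (by positivity)]
    refine Real.rpow_le_rpow_of_nonpos ht (by linarith) ?_
    have : (0 : ℝ) ≤ (2 * m + 1 : ℕ) := Nat.cast_nonneg _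
    nlinarith
  calc
    _ = a ^ 2 * b ^ (2 * m + 1) := by field_simp; ring
    _ ≤ t ^ (-1 : ℝ) * t ^ (-(1 : ℝ) / 2 * (2 * m + 1 : ℕ)) := by gcongr
    _ = _ := by
      rw [← Real.rpow_add ht, ← Real.rpow_natCast, ← Real.rpow_mul ht.le]
      congr 1
      push_cast; ring

theorem integrableOn_pow_mul_of_le {m k : ℕ} (hk : k ≤ m + 1) {w : ℝ → ℝ} (hw : Measurable w)
    (hi : IntegrableOn (fun z => (1 + z ^ (m + 1)) * |w z|) (Ioi 0)) :
    IntegrableOn (fun z => z ^ k * w z) (Ioi 0) := by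
  refine Integrable.mono' hi (by fun_prop) ?_
  filter_upwards [ae_restrict_mem measurableSet_Ioi] with z hz
  have hz0 : (0 : ℝ) < z := hz
  rw [norm_mul, norm_pow, Real.norm_of_nonneg hz0.le, Real.norm_eq_abs]
  gcongr
  rcases le_total z 1 with h | h
  · linarith [pow_le_one₀ (n := k) hz0.le h, pow_pos hz0 (m + 1)]
  · linarith [pow_le_pow_right₀ h hk]

theorem ENNReal.add_sq_le_two_mul (a b : ENNReal) : (a + b) ^ 2 ≤ 2 * a ^ 2 + 2 * b ^ 2 := by
  have := ENNReal.rpow_add_le_mul_rpow_add_rpow a b (p := 2) (by norm_num)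
  norm_num at this
  simpa [mul_add] using this

theorem statement8 (m : ℕ) :
    ∃ C > (0 : ℝ), ∀ vb : ℝ → ℝ, Continuous vb → (∃ M : ℝ, ∀ z : ℝ, |vb z| ≤ M) →
      (∀ z < (0 : ℝ), vb z = 0) →
      Integrable (fun z => (1 + z ^ (m + 1)) * |vb z|) (volume.restrict (Ioi (0 : ℝ))) →
      (∀ k : ℕ, k ≤ m → ∫ z in Ioi (0 : ℝ), z ^ k * vb z = 0) →
      ∀ t > (0 : ℝ),
        (∫ z in Ioi (0 : ℝ), (v vb t z) ^ 2) ^ ((1 : ℝ) / 2)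
          ≤ C * t ^ (-(1 : ℝ) / 4 - ((m : ℝ) + 1) / 2)
              * ∫ z in Ioi (0 : ℝ), z ^ (m + 1) * |vb z| := by
  set D := ∫⁻ x, ‖iteratedDeriv (m + 1) (fun y : ℝ => Real.exp (-(y ^ 2 / 2))) x‖ₑ ^ 2 with hD
  have hDtop : D < ⊤ := lintegral_sq_iteratedDeriv_gaussian_lt_top (m + 1)
  refine ⟨2 * √D.toReal + 1, by positivity, fun vb hcont _ _ hint hmom t ht => ?_⟩
  have hwm := hcont.measurable
  have hi : ∀ k ≤ m + 1, IntegrableOn (fun z => z ^ k * vb z) (Ioi 0) :=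
    fun k hk => integrableOn_pow_mul_of_le hk hwm hint
  set I := ∫ z in Ioi (0 : ℝ), z ^ (m + 1) * |vb z| with hI
  set τ := t ^ (-(1 : ℝ) / 4 - ((m : ℝ) + 1) / 2) with hτ
  have hτ0 : 0 ≤ τ := by positivity
  have hI0 : 0 ≤ I := setIntegral_nonneg measurableSet_Ioi fun z hz =>
    mul_nonneg (pow_nonneg (le_of_lt hz) _) (abs_nonneg _)
  have hIlint : ∫⁻ y in Ioi (0 : ℝ), ENNReal.ofReal (y ^ (m + 1)) * ‖vb y‖ₑ
      = ENNReal.ofReal I := by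
    have hnorm : ∀ z ∈ Ioi (0 : ℝ), ‖z ^ (m + 1) * vb z‖ = z ^ (m + 1) * |vb z| := fun z hz => by
      rw [norm_mul, Real.norm_of_nonneg (pow_nonneg (le_of_lt hz) _), Real.norm_eq_abs]
    rw [hI, ← setIntegral_congr_fun measurableSet_Ioi hnorm,
      ofReal_integral_norm_eq_lintegral_enorm (hi _ le_rfl)]
    refine setLIntegral_congr_fun measurableSet_Ioi fun z hz => ?_
    rw [enorm_mul, Real.enorm_of_nonneg (pow_nonneg (le_of_lt hz) _)]
  have hbound : ∀ σ : ℝ, |σ| = 1 →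
      ∫⁻ z, ‖∫ y in Ioi (0 : ℝ), G t (z + σ * y) * vb y‖ₑ ^ 2
        ≤ ENNReal.ofReal I ^ 2 * (ENNReal.ofReal (τ ^ 2) * D) := fun σ hσ => by
    rw [← hIlint]
    exact (lintegral_sq_enorm_integral_le (contDiff_G ht) (norm_G_le ht) hwm
      (fun k hk => hi k (by omega)) hmom hσ).trans
      (mul_le_mul_right (lintegral_sq_iteratedDeriv_G_le m ht) _)
  have hGc : Continuous (G t) := (contDiff_G ht (n := 0)).continuous
  have hmeas : ∀ σ : ℝ, Measurable fun z => ∫ y in Ioi (0 : ℝ), G t (z + σ * y) * vb y :=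
    fun σ => (StronglyMeasurable.integral_prod_right (by fun_prop)).measurable
  have hv : ∀ z, v vb t z = (∫ y in Ioi (0 : ℝ), G t (z + (-1) * y) * vb y)
      + ∫ y in Ioi (0 : ℝ), G t (z + 1 * y) * vb y := fun z => by
    have hint0 : ∀ σ : ℝ, IntegrableOn (fun y => G t (z + σ * y) * vb y) (Ioi 0) := fun σ =>
      Integrable.bdd_mul (by simpa [IntegrableOn] using hi 0 (Nat.zero_le _)) (by fun_prop)
        (Filter.Eventually.of_forall fun y => norm_G_le ht _)
    rw [← integral_add (hint0 _) (hint0 _), v]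
    simp only [neg_mul, one_mul, add_mul, sub_eq_add_neg]
  have hlint : ∫⁻ z in Ioi (0 : ℝ), ENNReal.ofReal ‖v vb t z ^ 2‖
      ≤ ENNReal.ofReal (4 * (I ^ 2 * (τ ^ 2 * D.toReal))) := by
    calc
      _ ≤ ∫⁻ z, ENNReal.ofReal ‖v vb t z ^ 2‖ := setLIntegral_le_lintegral _ _
      _ ≤ ∫⁻ z, (2 * ‖∫ y in Ioi (0 : ℝ), G t (z + (-1) * y) * vb y‖ₑ ^ 2
            + 2 * ‖∫ y in Ioi (0 : ℝ), G t (z + 1 * y) * vb y‖ₑ ^ 2) := by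
        refine lintegral_mono fun z => ?_
        rw [ofReal_norm, enorm_pow, hv]
        exact (pow_le_pow_left' (enorm_add_le _ _) 2).trans (ENNReal.add_sq_le_two_mul _ _)
      _ ≤ 2 * (ENNReal.ofReal I ^ 2 * (ENNReal.ofReal (τ ^ 2) * D))
            + 2 * (ENNReal.ofReal I ^ 2 * (ENNReal.ofReal (τ ^ 2) * D)) := by
        have := hmeas (-1)
        have := hmeas 1
        rw [lintegral_add_left (by fun_prop), lintegral_const_mul _ (by fun_prop),
          lintegral_const_mul _ (by fun_prop)]
        gcongr
        · exact hbound _ (by simp)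
        · exact hbound _ (by simp)
      _ = _ := by
        rw [ENNReal.ofReal_mul (by norm_num), ENNReal.ofReal_mul (by positivity),
          ENNReal.ofReal_mul (by positivity), ENNReal.ofReal_toReal hDtop.ne,
          ENNReal.ofReal_pow hI0, ← add_mul]
        norm_num
  have hreal : ∫ z in Ioi (0 : ℝ), v vb t z ^ 2 ≤ 4 * (I ^ 2 * (τ ^ 2 * D.toReal)) :=
    (Real.le_norm_self _).trans <| (norm_integral_le_lintegral_norm _).trans <|
      ENNReal.toReal_le_of_le_ofReal (by positivity) hlint
  rw [← Real.sqrt_eq_rpow]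
  refine Real.sqrt_le_iff.2 ⟨by positivity, hreal.trans ?_⟩
  calc
    _ = (2 * √D.toReal * τ * I) ^ 2 := by
      rw [mul_pow, mul_pow, mul_pow, Real.sq_sqrt ENNReal.toReal_nonneg]; ring
    _ ≤ _ := by gcongr; linarith
end
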